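/- arXiv:0707.1626 — 7 statements merged into one kernel-verified Lean document; each statement's English description precedes it below -/
import Mathlib

section
/- Let (X,‖·‖) be a uniformly convex real normed space, C ⊆ X a convex subset, and T : C → C an asymptotically nonexpansive mapping with sequence (k_n) in [0,∞) satisfying Σ_{i=0}^∞ k_i < ∞. Let (λ_n) be a sequence in [a,b] for some 0 < a < b < 1 and define the Krasnoselski–Mann iteration of T starting from x ∈ C by x_0 := x, x_{n+1} := (1−λ_n)x_n + λ_n T^n(x_n). If T has a fixed point, then ‖x_n − T(x_n)‖ → 0 as n → ∞. -/
open Filter Topology Set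

/-- A nonnegative real sequence with `d (n + 1) ≤ (1 + k n) * d n` and `k` nonnegative and summable
converges. -/
lemma exists_tendsto_of_le_one_add_mul {d k : ℕ → ℝ} (hd : ∀ n, 0 ≤ d n) (hk : ∀ n, 0 ≤ k n)
    (hsum : Summable k) (h : ∀ n, d (n + 1) ≤ (1 + k n) * d n) :
    ∃ l, Tendsto d atTop (𝓝 l) := by
  set P : ℕ → ℝ := fun n => ∏ i ∈ Finset.range n, (1 + k i) with hP
  have hPpos : ∀ n, 0 < P n := fun n =>
    Finset.prod_pos fun i _ => by linarith [hk i]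
  have hPsucc : ∀ n, P (n + 1) = P n * (1 + k n) := fun n => Finset.prod_range_succ _ _
  have hPmono : Monotone P := monotone_nat_of_le_succ fun n => by
    rw [hPsucc]
    exact le_mul_of_one_le_right (hPpos n).le (by linarith [hk n])
  have hPbdd : BddAbove (range P) := by
    refine ⟨Real.exp (∑' i, k i), ?_⟩
    rintro _ ⟨n, rfl⟩
    calc P n ≤ ∏ i ∈ Finset.range n, Real.exp (k i) :=
          Finset.prod_le_prod (fun i _ => by linarith [hk i])
            fun i _ => by linarith [Real.add_one_le_exp (k i)]
      _ = Real.exp (∑ i ∈ Finset.range n, k i) := (Real.exp_sum _ _).symm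
      _ ≤ _ := Real.exp_le_exp.2 (hsum.sum_le_tsum _ fun i _ => hk i)
  have hanti : Antitone fun n => d n / P n := antitone_nat_of_succ_le fun n => by
    rw [hPsucc, div_le_div_iff₀ (mul_pos (hPpos n) (by linarith [hk n])) (hPpos n)]
    nlinarith [mul_le_mul_of_nonneg_left (h n) (hPpos n).le]
  have hbdd : BddBelow (range fun n => d n / P n) := by
    refine ⟨0, ?_⟩
    rintro _ ⟨n, rfl⟩
    exact div_nonneg (hd n) (hPpos n).le
  refine ⟨_, ((tendsto_atTop_ciInf hanti hbdd).mul (tendsto_atTop_ciSup hPmono hPbdd)).congr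
    fun n => ?_⟩
  exact div_mul_cancel₀ _ (hPpos n).ne'

/-- Convex combinations with weights bounded away from `0`, in terms of a bound on the sum. -/
lemma norm_convexCombination_le {X : Type*} [NormedAddCommGroup X] [NormedSpace ℝ X]
    {u v : X} {R δ c t : ℝ} (hu : ‖u‖ ≤ R) (hv : ‖v‖ ≤ R) (huv : ‖u + v‖ ≤ R * (2 - δ))
    (hc : 0 ≤ c) (hct : c ≤ t) (hct' : c ≤ 1 - t) :
    ‖(1 - t) • u + t • v‖ ≤ R * (1 - c * δ) := by
  have key : (1 - t) • u + t • v = c • (u + v) + (1 - t - c) • u + (t - c) • v := by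
    module
  calc ‖(1 - t) • u + t • v‖ ≤ ‖c • (u + v)‖ + ‖(1 - t - c) • u‖ + ‖(t - c) • v‖ := by
        rw [key]; exact norm_add₃_le
    _ = c * ‖u + v‖ + (1 - t - c) * ‖u‖ + (t - c) * ‖v‖ := by
        rw [norm_smul_of_nonneg hc, norm_smul_of_nonneg (by linarith),
          norm_smul_of_nonneg (by linarith)]
    _ ≤ c * (R * (2 - δ)) + (1 - t - c) * R + (t - c) * R := by
        gcongr
    _ = R * (1 - c * δ) := by ring

/-- In a uniformly convex space, convex combinations of `ε`-separated points of a ball of radius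
at most `M`, with weights at least `c`, have norm smaller than the radius by a fixed amount. -/
lemma exists_norm_convexCombination_le_sub {X : Type*} [NormedAddCommGroup X] [NormedSpace ℝ X]
    (huc : ∀ ε > (0 : ℝ), ∃ δ > (0 : ℝ), ∀ x y : X,
      ‖x‖ ≤ 1 → ‖y‖ ≤ 1 → ε ≤ ‖x - y‖ → ‖x + y‖ ≤ 2 - δ)
    {ε M c : ℝ} (hε : 0 < ε) (hM : 0 < M) (hc : 0 < c) :
    ∃ η > 0, ∀ (u v : X) (R t : ℝ), R ≤ M → ‖u‖ ≤ R → ‖v‖ ≤ R → ε ≤ ‖u - v‖ → c ≤ t →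
      c ≤ 1 - t → ‖(1 - t) • u + t • v‖ ≤ R - η := by
  obtain ⟨δ, hδ, H⟩ := huc (ε / M) (div_pos hε hM)
  refine ⟨ε / 2 * (c * δ), by positivity, fun u v R t hRM hu hv huv hct hct' => ?_⟩
  have hεR : ε / 2 ≤ R := by linarith [norm_sub_le u v]
  have hR : 0 < R := by linarith
  have hsc : ∀ w : X, ‖R⁻¹ • w‖ = ‖w‖ / R := fun w => by
    rw [norm_smul_of_nonneg (inv_nonneg.2 hR.le), div_eq_inv_mul]
  have hsum : ‖R⁻¹ • u + R⁻¹ • v‖ ≤ 2 - δ := by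
    refine H _ _ ?_ ?_ ?_
    · rw [hsc]; exact (div_le_one hR).2 hu
    · rw [hsc]; exact (div_le_one hR).2 hv
    · rw [← smul_sub, hsc]
      gcongr
  rw [← smul_add, hsc, div_le_iff₀' hR] at hsum
  have := norm_convexCombination_le hu hv hsum hc.le hct hct'
  have := mul_le_mul_of_nonneg_right hεR (mul_pos hc hδ).le
  linarith


/-- asymptotic regularity of the Krasnoselski–Mann iteration of an
asymptotically nonexpansive selfmap of a convex subset of a uniformly convex normed space,
provided `T` has a fixed point. -/
theorem asymptotic_regularity_uniformly_convex_normed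
    {X : Type*} [NormedAddCommGroup X] [NormedSpace ℝ X]
    (huc : ∀ ε > (0:ℝ), ∃ δ > (0:ℝ), ∀ x y : X,
      ‖x‖ ≤ 1 → ‖y‖ ≤ 1 → ε ≤ ‖x - y‖ → ‖x + y‖ ≤ 2 - δ)
    (C : Set X) (hconv : Convex ℝ C)
    (T : X → X) (hT : Set.MapsTo T C C)
    (k : ℕ → ℝ) (hk : ∀ n, 0 ≤ k n)
    (hklim : Filter.Tendsto k Filter.atTop (nhds 0))
    (hane : ∀ n : ℕ, ∀ x ∈ C, ∀ y ∈ C, ‖T^[n] x - T^[n] y‖ ≤ (1 + k n) * ‖x - y‖)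
    (hsum : Summable k)
    (a b : ℝ) (ha : 0 < a) (hab : a < b) (hb : b < 1)
    (lam : ℕ → ℝ) (hlam : ∀ n, lam n ∈ Set.Icc a b)
    (hfix : ∃ p ∈ C, T p = p)
    (x : X) (hx : x ∈ C) (xseq : ℕ → X) (hx0 : xseq 0 = x)
    (hrec : ∀ n, xseq (n + 1) = (1 - lam n) • xseq n + lam n • T^[n] (xseq n)) :
    Filter.Tendsto (fun n => ‖xseq n - T (xseq n)‖) Filter.atTop (nhds 0) := by
  obtain ⟨p, hpC, hp⟩ := hfix
  have hTn : ∀ n, MapsTo T^[n] C C := fun n => hT.iterate n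
  have hpn : ∀ n, T^[n] p = p := fun n => Function.iterate_fixed hp n
  have hxC : ∀ n, xseq n ∈ C := fun n => by
    induction n with
    | zero => rwa [hx0]
    | succ n ih =>
      rw [hrec]
      exact hconv ih (hTn n ih) (by linarith [(hlam n).2]) (by linarith [(hlam n).1]) (by ring)
  have hstep : ∀ n, xseq (n + 1) - p =
      (1 - lam n) • (xseq n - p) + lam n • (T^[n] (xseq n) - p) := fun n => by
    rw [hrec]; module
  have hTd : ∀ n, ‖T^[n] (xseq n) - p‖ ≤ (1 + k n) * ‖xseq n - p‖ := fun n => by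
    simpa only [hpn] using hane n _ (hxC n) p hpC
  have hd : ∀ n, ‖xseq n - p‖ ≤ (1 + k n) * ‖xseq n - p‖ := fun n =>
    le_mul_of_one_le_left (norm_nonneg _) (by linarith [hk n])
  have hdec : ∀ n, ‖xseq (n + 1) - p‖ ≤ (1 + k n) * ‖xseq n - p‖ := fun n => by
    rw [hstep]
    simpa using norm_convexCombination_le (δ := 0) (c := 0) (hd n) (hTd n)
      (by linarith [norm_add_le (xseq n - p) (T^[n] (xseq n) - p), hd n, hTd n]) le_rfl
      (by linarith [(hlam n).1]) (by linarith [(hlam n).2])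
  obtain ⟨l, hl⟩ := exists_tendsto_of_le_one_add_mul (fun n => norm_nonneg (xseq n - p)) hk hsum hdec
  have hR : Tendsto (fun n => (1 + k n) * ‖xseq n - p‖) atTop (𝓝 l) := by
    simpa using (hklim.const_add 1).mul hl
  have hgap : Tendsto (fun n => (1 + k n) * ‖xseq n - p‖ - ‖xseq (n + 1) - p‖) atTop (𝓝 0) := by
    simpa using hR.sub (hl.comp (tendsto_add_atTop_nat 1))
  have hl0 : 0 ≤ l := ge_of_tendsto' hl fun n => norm_nonneg _
  have he : Tendsto (fun n => ‖xseq n - T^[n] (xseq n)‖) atTop (𝓝 0) := by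
    refine tendsto_order.2 ⟨fun r hr => .of_forall fun n => hr.trans_le (norm_nonneg _),
      fun ε hε => ?_⟩
    obtain ⟨η, hη, H⟩ := exists_norm_convexCombination_le_sub huc (M := l + 1) (c := min a (1 - b))
      hε (by linarith) (lt_min ha (by linarith))
    filter_upwards [hgap.eventually_lt_const hη, hR.eventually_lt_const (lt_add_one l)]
      with n hn hn'
    by_contra! hcon
    have := H (xseq n - p) (T^[n] (xseq n) - p) _ (lam n) hn'.le (hd n) (hTd n)
      (by rwa [sub_sub_sub_cancel_right]) ((min_le_left _ _).trans (hlam n).1)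
      ((min_le_right _ _).trans (by linarith [(hlam n).2]))
    rw [← hstep] at this
    linarith
  have hinc : ∀ n, ‖xseq (n + 1) - xseq n‖ ≤ ‖xseq n - T^[n] (xseq n)‖ := fun n => by
    have : xseq (n + 1) - xseq n = lam n • (T^[n] (xseq n) - xseq n) := by
      rw [hrec]; module
    rw [this, norm_smul_of_nonneg (by linarith [(hlam n).1]), norm_sub_rev]
    exact mul_le_of_le_one_left (norm_nonneg _) (by linarith [(hlam n).2])
  have hbound : ∀ n, ‖xseq (n + 1) - T (xseq (n + 1))‖ ≤
      ‖xseq (n + 1) - T^[n + 1] (xseq (n + 1))‖ +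
        (1 + k 1) * ((3 + k n) * ‖xseq n - T^[n] (xseq n)‖) := fun n => by
    have h1 : ‖T^[n + 1] (xseq (n + 1)) - T (xseq (n + 1))‖ ≤
        (1 + k 1) * ‖T^[n] (xseq (n + 1)) - xseq (n + 1)‖ := by
      simpa only [Function.iterate_zero_apply, Function.iterate_succ_apply'] using
        hane 1 _ (hTn n (hxC (n + 1))) _ (hxC (n + 1))
    have h2 : ‖T^[n] (xseq (n + 1)) - xseq (n + 1)‖ ≤
        (3 + k n) * ‖xseq n - T^[n] (xseq n)‖ := by
      have h3 := hane n _ (hxC (n + 1)) _ (hxC n)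
      have h4 := mul_le_mul_of_nonneg_left (hinc n) (show 0 ≤ 1 + k n by linarith [hk n])
      have h5 := norm_sub_le_norm_sub_add_norm_sub (T^[n] (xseq (n + 1))) (T^[n] (xseq n))
        (xseq (n + 1))
      have h6 := norm_sub_le_norm_sub_add_norm_sub (T^[n] (xseq n)) (xseq n) (xseq (n + 1))
      rw [norm_sub_rev _ (xseq n), norm_sub_rev (xseq n) (xseq (n + 1))] at h6
      linarith [hinc n]
    have h7 := mul_le_mul_of_nonneg_left h2 (show 0 ≤ 1 + k 1 by linarith [hk 1])
    linarith [norm_sub_le_norm_sub_add_norm_sub (xseq (n + 1)) (T^[n + 1] (xseq (n + 1)))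
      (T (xseq (n + 1)))]
  rw [← tendsto_add_atTop_iff_nat 1]
  refine squeeze_zero (fun n => norm_nonneg _) hbound ?_
  simpa using (he.comp (tendsto_add_atTop_nat 1)).add
    (((hklim.const_add 3).mul he).const_mul (1 + k 1))
end

section
/- Nonempty closed convex and bounded subsets of uniformly convex real Banach spaces have the fixed point property for asymptotically nonexpansive mappings: if X is a uniformly convex real Banach space, C ⊆ X is a nonempty closed convex bounded subset, and T : C → C is asymptotically nonexpansive, then T has a fixed point. -/
open Filter Topology

/-- In a uniformly convex space, points of a convex set whose asymptotic radius with respect to a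
sequence is nearly minimal are close to each other. -/
theorem norm_sub_lt_of_eventually_norm_sub_le
    {X : Type*} [NormedAddCommGroup X] [NormedSpace ℝ X]
    (huc : ∀ ε > (0:ℝ), ∃ δ > (0:ℝ), ∀ x y : X,
      ‖x‖ ≤ 1 → ‖y‖ ≤ 1 → ε ≤ ‖x - y‖ → ‖x + y‖ ≤ 2 - δ)
    {C : Set X} (hconv : Convex ℝ C) (u : ℕ → X) {R : ℝ} (hR0 : 0 ≤ R)
    (hR : ∀ y ∈ C, ∀ r, (∀ᶠ n in atTop, ‖u n - y‖ ≤ r) → R ≤ r) {ε : ℝ} (hε : 0 < ε) :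
    ∃ η > 0, ∀ y ∈ C, ∀ z ∈ C, (∀ᶠ n in atTop, ‖u n - y‖ ≤ R + η) →
      (∀ᶠ n in atTop, ‖u n - z‖ ≤ R + η) → ‖y - z‖ < ε := by
  obtain ⟨δ, hδ, h⟩ := huc (ε / (R + 1)) (by positivity)
  refine ⟨min 1 (ε * δ / 8), by positivity, fun y hy z hz huy huz => ?_⟩
  have hη0 : 0 < min 1 (ε * δ / 8) := by positivity
  have hη1 := min_le_left 1 (ε * δ / 8)
  have hη2 := min_le_right 1 (ε * δ / 8)
  generalize min 1 (ε * δ / 8) = η at *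
  by_contra! hyz
  set r := R + η with hr
  have hr0 : 0 < r := by positivity
  have hεr : ε ≤ 2 * r := by
    obtain ⟨n, hny, hnz⟩ := (huy.and huz).exists
    have := norm_sub_le (u n - z) (u n - y)
    rw [sub_sub_sub_cancel_left] at this
    linarith
  have hmid : ∀ᶠ n in atTop, ‖u n - midpoint ℝ y z‖ ≤ r * (1 - δ / 2) := by
    filter_upwards [huy, huz] with n hny hnz
    have hscale (v : X) : ‖r⁻¹ • v‖ = ‖v‖ / r := by
      rw [norm_smul_of_nonneg (by positivity), div_eq_inv_mul]
    have key := h (r⁻¹ • (u n - y)) (r⁻¹ • (u n - z))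
      (by rw [hscale]; exact (div_le_one hr0).2 hny)
      (by rw [hscale]; exact (div_le_one hr0).2 hnz)
      (by
        rw [← smul_sub, hscale, sub_sub_sub_cancel_left, norm_sub_rev]
        gcongr
        linarith)
    rw [← smul_add, hscale, div_le_iff₀ hr0] at key
    have hsum : u n - midpoint ℝ y z = (2⁻¹ : ℝ) • ((u n - y) + (u n - z)) := by
      rw [midpoint_eq_smul_add, invOf_eq_inv]
      module
    rw [hsum, norm_smul_of_nonneg (by norm_num)]
    linarith
  have hle := hR _ (hconv.midpoint_mem hy hz) _ hmid
  nlinarith [mul_le_mul_of_nonneg_right hεr hδ.le, mul_pos hε hδ]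

/-- In a uniformly convex Banach space, every bounded sequence has an asymptotic center in every
nonempty closed convex set. -/
theorem exists_asymptotic_center
    {X : Type*} [NormedAddCommGroup X] [NormedSpace ℝ X] [CompleteSpace X]
    (huc : ∀ ε > (0:ℝ), ∃ δ > (0:ℝ), ∀ x y : X,
      ‖x‖ ≤ 1 → ‖y‖ ≤ 1 → ε ≤ ‖x - y‖ → ‖x + y‖ ≤ 2 - δ)
    {C : Set X} (hne : C.Nonempty) (hcl : IsClosed C) (hconv : Convex ℝ C)
    {u : ℕ → X} (hu : Bornology.IsBounded (Set.range u)) :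
    ∃ R : ℝ, 0 ≤ R ∧ (∀ y ∈ C, ∀ r, (∀ᶠ n in atTop, ‖u n - y‖ ≤ r) → R ≤ r) ∧
      ∃ z ∈ C, ∀ η > 0, ∀ᶠ n in atTop, ‖u n - z‖ ≤ R + η := by
  set S : Set ℝ := {r | ∃ y ∈ C, ∀ᶠ n in atTop, ‖u n - y‖ ≤ r}
  have hS0 : ∀ r ∈ S, 0 ≤ r := by
    rintro r ⟨y, -, hy⟩
    obtain ⟨n, hn⟩ := hy.exists
    exact (norm_nonneg _).trans hn
  have hSne : S.Nonempty := by
    obtain ⟨y, hy⟩ := hne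
    obtain ⟨B, hB⟩ := hu.exists_norm_le
    exact ⟨B + ‖y‖, y, hy, .of_forall fun n =>
      norm_sub_le_of_le (hB _ (Set.mem_range_self n)) le_rfl⟩
  have hR0 : 0 ≤ sInf S := Real.sInf_nonneg hS0
  have hR : ∀ y ∈ C, ∀ r, (∀ᶠ n in atTop, ‖u n - y‖ ≤ r) → sInf S ≤ r :=
    fun y hy r hr => csInf_le ⟨0, hS0⟩ ⟨y, hy, hr⟩
  refine ⟨sInf S, hR0, hR, ?_⟩
  have happrox (j : ℕ) : ∃ y ∈ C, ∀ᶠ n in atTop, ‖u n - y‖ ≤ sInf S + 1 / ((j : ℝ) + 1) := by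
    obtain ⟨r, ⟨y, hy, hyr⟩, hr⟩ := exists_lt_of_csInf_lt hSne
      (lt_add_of_pos_right (sInf S) (Nat.one_div_pos_of_nat (n := j)))
    exact ⟨y, hy, hyr.mono fun n hn => hn.trans hr.le⟩
  choose y hyC hy using happrox
  have hsmall {η : ℝ} (hη : 0 < η) : ∀ᶠ j in atTop, ∀ᶠ n in atTop, ‖u n - y j‖ ≤ sInf S + η := by
    filter_upwards [tendsto_one_div_add_atTop_nhds_zero_nat.eventually_le_const hη] with j hj
    filter_upwards [hy j] with n hn
    linarith
  have hcauchy : CauchySeq y := by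
    refine Metric.cauchySeq_iff.2 fun ε hε => ?_
    obtain ⟨η, hη, h⟩ := norm_sub_lt_of_eventually_norm_sub_le huc hconv u hR0 hR hε
    obtain ⟨N, hN⟩ := eventually_atTop.1 (hsmall hη)
    exact ⟨N, fun m hm n hn => dist_eq_norm (y m) (y n) ▸
      h _ (hyC m) _ (hyC n) (hN m hm) (hN n hn)⟩
  obtain ⟨z, hz⟩ := cauchySeq_tendsto_of_complete hcauchy
  refine ⟨z, hcl.mem_of_tendsto hz (.of_forall hyC), fun η hη => ?_⟩
  obtain ⟨j, hj, hjz⟩ := ((hsmall (half_pos hη)).and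
    (Metric.tendsto_nhds.1 hz _ (half_pos hη))).exists
  filter_upwards [hj] with n hn
  rw [dist_eq_norm] at hjz
  have := norm_sub_le_norm_sub_add_norm_sub (u n) (y j) z
  linarith


/-- (Goebel–Kirk) nonempty closed convex bounded subsets of uniformly convex
real Banach spaces have the fixed point property for asymptotically nonexpansive mappings. -/
theorem fpp_asymptotically_nonexpansive_uc_banach
    {X : Type*} [NormedAddCommGroup X] [NormedSpace ℝ X] [CompleteSpace X]
    (huc : ∀ ε > (0:ℝ), ∃ δ > (0:ℝ), ∀ x y : X,
      ‖x‖ ≤ 1 → ‖y‖ ≤ 1 → ε ≤ ‖x - y‖ → ‖x + y‖ ≤ 2 - δ)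
    (C : Set X) (hne : C.Nonempty) (hcl : IsClosed C) (hconv : Convex ℝ C)
    (hbd : Bornology.IsBounded C)
    (T : X → X) (hT : Set.MapsTo T C C)
    (k : ℕ → ℝ) (hk : ∀ n, 0 ≤ k n)
    (hklim : Filter.Tendsto k Filter.atTop (nhds 0))
    (hane : ∀ n : ℕ, ∀ x ∈ C, ∀ y ∈ C, ‖T^[n] x - T^[n] y‖ ≤ (1 + k n) * ‖x - y‖) :
    ∃ p ∈ C, T p = p := by
  obtain ⟨x, hx⟩ := hne
  have hiter (n : ℕ) : ∀ y ∈ C, T^[n] y ∈ C := fun y hy => hT.iterate n hy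
  obtain ⟨R, hR0, hR, z, hzC, hz⟩ := exists_asymptotic_center huc ⟨x, hx⟩ hcl hconv
    (u := fun n => T^[n] x) (hbd.subset (Set.range_subset_iff.2 fun n => hiter n x hx))
  have hlim : Tendsto (fun m => T^[m] z) atTop (𝓝 z) := by
    refine Metric.tendsto_nhds.2 fun ε hε => ?_
    obtain ⟨η, hη, h⟩ := norm_sub_lt_of_eventually_norm_sub_le huc hconv _ hR0 hR hε
    have hk' : Tendsto (fun m => (1 + k m) * (R + η / 2)) atTop (𝓝 ((1 + 0) * (R + η / 2))) :=
      (hklim.const_add 1).mul_const _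
    filter_upwards [hk'.eventually_le_const (show (1 + 0) * (R + η / 2) < R + η by linarith)]
      with m hm
    rw [dist_eq_norm]
    refine h _ (hiter m z hzC) z hzC ?_ (hz η hη)
    rw [← eventually_map (m := fun n => n) (P := fun n => ‖T^[n] x - T^[m] z‖ ≤ R + η),
      map_id', ← map_add_atTop_eq_nat m, eventually_map]
    filter_upwards [hz _ (half_pos hη)] with n hn
    rw [add_comm n m, Function.iterate_add_apply]
    refine (hane m _ (hiter n x hx) z hzC).trans (le_trans ?_ hm)
    have := hk m
    gcongr
  have hlimT : Tendsto (fun m => T^[m + 1] z) atTop (𝓝 (T z)) := by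
    refine tendsto_iff_norm_sub_tendsto_zero.2 ?_
    have hb : Tendsto (fun m => (1 + k 1) * ‖T^[m] z - z‖) atTop (𝓝 0) := by
      simpa using (tendsto_iff_norm_sub_tendsto_zero.1 hlim).const_mul (1 + k 1)
    refine squeeze_zero (fun _ => norm_nonneg _) (fun m => ?_) hb
    simpa [Function.iterate_succ_apply'] using hane 1 _ (hiter m z hzC) z hzC
  exact ⟨z, hzC, tendsto_nhds_unique hlimT (hlim.comp (tendsto_add_atTop_nat 1))⟩
end

section
/- Let (a_n), (b_n), (c_n) be sequences of nonnegative real numbers such that the series Σ b_n and Σ c_n are bounded (i.e. their partial sums are bounded) and a_{n+1} ≤ (1 + b_n)·a_n + c_n for all n ∈ ℕ. Then the sequence (a_n) is convergent. -/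
/-- Discrete Grönwall bound for `a (n + 1) ≤ (1 + b n) * a n + c n`. -/
theorem le_exp_sum_mul_of_succ_le {a b c : ℕ → ℝ}
    (ha : ∀ n, 0 ≤ a n) (hb : ∀ n, 0 ≤ b n) (hc : ∀ n, 0 ≤ c n)
    (hrec : ∀ n, a (n + 1) ≤ (1 + b n) * a n + c n) (n : ℕ) :
    a n ≤ Real.exp (∑ i ∈ Finset.range n, b i) * (a 0 + ∑ i ∈ Finset.range n, c i) := by
  induction n with
  | zero => simp
  | succ n ih =>
    rw [Finset.sum_range_succ, Finset.sum_range_succ]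
    set S := ∑ i ∈ Finset.range n, b i
    set T := ∑ i ∈ Finset.range n, c i
    have hS0 : 0 ≤ S := Finset.sum_nonneg fun i _ => hb i
    have hexp : 1 + b n ≤ Real.exp (b n) := by linarith [Real.add_one_le_exp (b n)]
    have hone : 1 ≤ Real.exp (S + b n) := Real.one_le_exp (add_nonneg hS0 (hb n))
    calc a (n + 1) ≤ (1 + b n) * a n + c n := hrec n
      _ ≤ Real.exp (b n) * (Real.exp S * (a 0 + T)) + Real.exp (S + b n) * c n :=
        add_le_add (mul_le_mul hexp ih (ha n) (Real.exp_nonneg _))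
          (le_mul_of_one_le_left (hc n) hone)
      _ = Real.exp (S + b n) * (a 0 + (T + c n)) := by rw [Real.exp_add]; ring

/-- A sequence bounded below whose increments are at most the terms of a summable series
converges. -/
theorem exists_tendsto_of_succ_le_add_summable {a d : ℕ → ℝ} (ha : BddBelow (Set.range a))
    (hd : Summable d) (h : ∀ n, a (n + 1) ≤ a n + d n) :
    ∃ l : ℝ, Filter.Tendsto a Filter.atTop (nhds l) := by
  have hsum := hd.hasSum.tendsto_sum_nat
  have hanti : Antitone fun n => a n - ∑ i ∈ Finset.range n, d i :=
    antitone_nat_of_succ_le fun n => by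
      rw [Finset.sum_range_succ]
      linarith [h n]
  obtain ⟨m, hm⟩ := ha
  obtain ⟨D, hD⟩ := hsum.bddAbove_range
  have hbdd : BddBelow (Set.range fun n => a n - ∑ i ∈ Finset.range n, d i) :=
    ⟨m - D, by
      rintro _ ⟨n, rfl⟩
      exact sub_le_sub (hm ⟨n, rfl⟩) (hD ⟨n, rfl⟩)⟩
  exact ⟨_, by simpa using (tendsto_atTop_ciInf hanti hbdd).add hsum⟩

/-- (Qihou's lemma) if `a_{n+1} ≤ (1+b_n)a_n + c_n` with `(a_n),(b_n),(c_n)`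
nonnegative and the partial sums of `∑ b_n` and `∑ c_n` bounded, then `(a_n)` converges. -/
theorem qihou_convergence_lemma
    (a b c : ℕ → ℝ)
    (ha : ∀ n, 0 ≤ a n) (hb : ∀ n, 0 ≤ b n) (hc : ∀ n, 0 ≤ c n)
    (hB : ∃ B : ℝ, ∀ n : ℕ, ∑ i ∈ Finset.range n, b i ≤ B)
    (hC : ∃ C : ℝ, ∀ n : ℕ, ∑ i ∈ Finset.range n, c i ≤ C)
    (hrec : ∀ n, a (n + 1) ≤ (1 + b n) * a n + c n) :
    ∃ l : ℝ, Filter.Tendsto a Filter.atTop (nhds l) := by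
  obtain ⟨B, hB⟩ := hB
  obtain ⟨C, hC⟩ := hC
  have hbound (n : ℕ) : a n ≤ Real.exp B * (a 0 + C) :=
    (le_exp_sum_mul_of_succ_le ha hb hc hrec n).trans <|
      mul_le_mul (Real.exp_le_exp.2 (hB n)) (by linarith [hC n])
        (add_nonneg (ha 0) (Finset.sum_nonneg fun i _ => hc i)) (Real.exp_nonneg _)
  refine exists_tendsto_of_succ_le_add_summable (d := fun n => b n * (Real.exp B * (a 0 + C)) + c n)
    ⟨0, by rintro _ ⟨n, rfl⟩; exact ha n⟩
    (((summable_of_sum_range_le hb hB).mul_right _).add (summable_of_sum_range_le hc hC))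
    fun n => ?_
  linarith [hrec n, mul_le_mul_of_nonneg_left (hbound n) (hb n)]
end

section
/- Let (X,d,W) be a uniformly convex hyperbolic space with modulus of uniform convexity η. Let r > 0, ε ∈ (0,2] and a,x,y ∈ X be such that d(x,a) ≤ r, d(y,a) ≤ r and d(x,y) ≥ ε·r. Then for every λ ∈ [0,1]: (1) d((1−λ)x ⊕ λy, a) ≤ (1 − 2λ(1−λ)·η(r,ε))·r; (2) for every ψ ∈ (0,2] with ψ ≤ ε, d((1−λ)x ⊕ λy, a) ≤ (1 − 2λ(1−λ)·η(r,ψ))·r; (3) for every s ≥ r, d((1−λ)x ⊕ λy, a) ≤ (1 − 2λ(1−λ)·η(s, ε·r/s))·s. -/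
open Filter Set

section Hyperbolic

variable {X : Type*}

/-- A hyperbolic space structure: `W x y t` represents `(1-t)x ⊕ t y`. -/
structure IsWMap [MetricSpace X] (W : X → X → ℝ → X) : Prop where
  w1 : ∀ (x y z : X), ∀ t ∈ Set.Icc (0:ℝ) 1,
    dist z (W x y t) ≤ (1 - t) * dist z x + t * dist z y
  w2 : ∀ (x y : X), ∀ t ∈ Set.Icc (0:ℝ) 1, ∀ s ∈ Set.Icc (0:ℝ) 1,
    dist (W x y t) (W x y s) = |t - s| * dist x y
  w3 : ∀ (x y : X), ∀ t ∈ Set.Icc (0:ℝ) 1, W x y t = W y x (1 - t)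
  w4 : ∀ (x y z w : X), ∀ t ∈ Set.Icc (0:ℝ) 1,
    dist (W x z t) (W y w t) ≤ (1 - t) * dist x y + t * dist z w

/-- `η` is a modulus of uniform convexity for the hyperbolic space `(X, dist, W)`. -/
def IsUCModulus [MetricSpace X] (W : X → X → ℝ → X) (η : ℝ → ℝ → ℝ) : Prop :=
  (∀ r ε : ℝ, 0 < r → ε ∈ Set.Ioc (0:ℝ) 2 → η r ε ∈ Set.Ioc (0:ℝ) 1) ∧
  (∀ r ε : ℝ, ∀ a x y : X, 0 < r → ε ∈ Set.Ioc (0:ℝ) 2 →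
    dist x a ≤ r → dist y a ≤ r → ε * r ≤ dist x y →
    dist (W x y (1/2)) a ≤ (1 - η r ε) * r)

/-- The modulus `η` is monotone: nonincreasing in `r` for each fixed `ε`. -/
def MonotoneUCModulus (η : ℝ → ℝ → ℝ) : Prop :=
  ∀ ε ∈ Set.Ioc (0:ℝ) 2, ∀ r s : ℝ, 0 < r → r ≤ s → η s ε ≤ η r ε

/-- `C` is a convex subset w.r.t. the convexity map `W`. -/
def WConvex [MetricSpace X] (W : X → X → ℝ → X) (C : Set X) : Prop :=
  ∀ x ∈ C, ∀ y ∈ C, ∀ t ∈ Set.Icc (0:ℝ) 1, W x y t ∈ C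

/-- `T : C → C` is asymptotically nonexpansive with sequence `k`. -/
def AsymptoticallyNonexpansive [MetricSpace X] (C : Set X) (T : X → X) (k : ℕ → ℝ) : Prop :=
  Set.MapsTo T C C ∧ (∀ n, 0 ≤ k n) ∧
  Filter.Tendsto k Filter.atTop (nhds 0) ∧
  ∀ n : ℕ, ∀ x ∈ C, ∀ y ∈ C, dist (T^[n] x) (T^[n] y) ≤ (1 + k n) * dist x y

/-- `xseq` is the Krasnoselski–Mann iteration of `T` starting from `x`:
`x₀ = x`, `x_{n+1} = (1-λ_n) x_n ⊕ λ_n T^n x_n`. -/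
def IsKMIteration [MetricSpace X] (W : X → X → ℝ → X) (T : X → X) (lam : ℕ → ℝ)
    (x : X) (xseq : ℕ → X) : Prop :=
  xseq 0 = x ∧ ∀ n, xseq (n + 1) = W (xseq n) (T^[n] (xseq n)) (lam n)

end Hyperbolic

namespace IsWMap

variable {X : Type*} [MetricSpace X] {W : X → X → ℝ → X} {η : ℝ → ℝ → ℝ}

/-- The distance from `x` to `W x y t`. -/
lemma dist_left (hW : IsWMap W) (x y : X) {t : ℝ} (ht : t ∈ Set.Icc (0:ℝ) 1) :
    dist x (W x y t) = t * dist x y := by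
  have h0 : W x y 0 = x := by
    have h := hW.w1 x y x 0 (by simp)
    rw [dist_self] at h
    exact (dist_le_zero.1 (by linarith)).symm
  have h := hW.w2 x y 0 (by simp) t ht
  rwa [h0, zero_sub, abs_neg, abs_of_nonneg ht.1] at h

/-- Points of a uniformly convex hyperbolic space are determined by their distances to the
endpoints of a geodesic through them. -/
lemma eq_of_dist_le (hW : IsWMap W) (hUC : IsUCModulus W η) {x m z z' : X} {p q : ℝ}
    (hpq : p + q = dist x m) (hzx : dist z x ≤ p) (hzx' : dist z' x ≤ p)
    (hzm : dist z m ≤ q) (hzm' : dist z' m ≤ q) : z = z' := by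
  by_contra hne
  have hd : 0 < dist z z' := dist_pos.2 hne
  have htri : dist z z' ≤ 2 * p := by
    linarith [dist_triangle_right z z' x]
  have hp : 0 < p := by linarith
  have hε : dist z z' / p ∈ Set.Ioc (0:ℝ) 2 := ⟨by positivity, (div_le_iff₀ hp).2 htri⟩
  have hmid := hUC.2 p _ x z z' hp hε hzx hzx' (div_mul_cancel₀ _ hp.ne').le
  have hη := mul_pos (hUC.1 p _ hp hε).1 hp
  have hm := hW.w1 z z' m (1/2) (by norm_num)
  rw [dist_comm m z, dist_comm m z'] at hm
  have := dist_triangle_left x m (W z z' (1/2))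
  rw [dist_comm (W z z' (1/2)) m] at this
  linarith

/-- The first half of the segment from `x` to `y` is the segment from `x` to the midpoint. -/
lemma eq_comp_half (hW : IsWMap W) (hUC : IsUCModulus W η) (x y : X) {t : ℝ}
    (h0 : 0 ≤ t) (h1 : t ≤ 1 / 2) : W x y t = W x (W x y (1/2)) (2 * t) := by
  have hhalf : (1/2 : ℝ) ∈ Set.Icc (0:ℝ) 1 := by norm_num
  have ht : t ∈ Set.Icc (0:ℝ) 1 := ⟨h0, by linarith⟩
  have ht2 : 2 * t ∈ Set.Icc (0:ℝ) 1 := ⟨by linarith, by linarith⟩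
  have hm := hW.dist_left x y hhalf
  refine hW.eq_of_dist_le hUC (x := x) (m := W x y (1/2)) (p := t * dist x y)
    (q := (1/2 - t) * dist x y) (by rw [hm]; ring) ?_ ?_ ?_ ?_
  · rw [dist_comm, hW.dist_left x y ht]
  · rw [dist_comm, hW.dist_left x _ ht2, hm]
    linarith
  · rw [hW.w2 x y t ht _ hhalf, abs_sub_comm, abs_of_nonneg (by linarith)]
  · have h := hW.w1 x (W x y (1/2)) (W x y (1/2)) (2 * t) ht2
    rw [dist_self, dist_comm _ x, hm] at h
    rw [dist_comm]
    linarith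

lemma dist_le_of_le_half (hW : IsWMap W) (hUC : IsUCModulus W η) {r ε : ℝ} (hr : 0 < r)
    (hε : ε ∈ Set.Ioc (0:ℝ) 2) {a x y : X} (hx : dist x a ≤ r) (hy : dist y a ≤ r)
    (hxy : ε * r ≤ dist x y) {t : ℝ} (h0 : 0 ≤ t) (h1 : t ≤ 1 / 2) :
    dist (W x y t) a ≤ (1 - 2 * t * (1 - t) * η r ε) * r := by
  have hm := hUC.2 r ε a x y hr hε hx hy hxy
  have hη := mul_pos (hUC.1 r ε hr hε).1 hr
  have h := hW.w1 x (W x y (1/2)) a (2 * t) ⟨by linarith, by linarith⟩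
  rw [← hW.eq_comp_half hUC x y h0 h1, dist_comm a, dist_comm a, dist_comm a] at h
  have e1 := mul_le_mul_of_nonneg_left hx (by linarith : 0 ≤ 1 - 2 * t)
  have e2 := mul_le_mul_of_nonneg_left hm (by linarith : 0 ≤ 2 * t)
  have e3 := mul_nonneg (mul_nonneg h0 h0) hη.le
  linarith

/-- Uniform convexity extends from midpoints to arbitrary convex combinations. -/
lemma dist_le (hW : IsWMap W) (hUC : IsUCModulus W η) {r ε : ℝ} (hr : 0 < r)
    (hε : ε ∈ Set.Ioc (0:ℝ) 2) {a x y : X} (hx : dist x a ≤ r) (hy : dist y a ≤ r)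
    (hxy : ε * r ≤ dist x y) {t : ℝ} (ht : t ∈ Set.Icc (0:ℝ) 1) :
    dist (W x y t) a ≤ (1 - 2 * t * (1 - t) * η r ε) * r := by
  rcases le_total t (1/2) with h | h
  · exact hW.dist_le_of_le_half hUC hr hε hx hy hxy ht.1 h
  · rw [hW.w3 x y t ht]
    have := hW.dist_le_of_le_half hUC hr hε hy hx (dist_comm x y ▸ hxy)
      (t := 1 - t) (by linarith [ht.2]) (by linarith)
    linarith

end IsWMap

/-- basic inequalities for a modulus of uniform convexity (Lemma 2.1). -/
theorem uc_modulus_inequalities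
    {X : Type*} [MetricSpace X]
    (W : X → X → ℝ → X) (η : ℝ → ℝ → ℝ)
    (hW : IsWMap W) (hUC : IsUCModulus W η)
    (r ε : ℝ) (hr : 0 < r) (hε : ε ∈ Set.Ioc (0:ℝ) 2)
    (a x y : X) (hx : dist x a ≤ r) (hy : dist y a ≤ r) (hxy : ε * r ≤ dist x y)
    (t : ℝ) (ht : t ∈ Set.Icc (0:ℝ) 1) :
    dist (W x y t) a ≤ (1 - 2 * t * (1 - t) * η r ε) * r ∧
    (∀ ψ : ℝ, 0 < ψ → ψ ≤ ε → dist (W x y t) a ≤ (1 - 2 * t * (1 - t) * η r ψ) * r) ∧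
    (∀ s : ℝ, r ≤ s → dist (W x y t) a ≤ (1 - 2 * t * (1 - t) * η s (ε * r / s)) * s) := by
  refine ⟨hW.dist_le hUC hr hε hx hy hxy ht, fun ψ hψ hψε => ?_, fun s hs => ?_⟩
  · exact hW.dist_le hUC hr ⟨hψ, hψε.trans hε.2⟩ hx hy
      ((mul_le_mul_of_nonneg_right hψε hr.le).trans hxy) ht
  · have hs0 : 0 < s := hr.trans_le hs
    have hεr : 0 < ε * r := mul_pos hε.1 hr
    refine hW.dist_le hUC hs0 ⟨div_pos hεr hs0, (div_le_iff₀ hs0).2 ?_⟩ (hx.trans hs)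
      (hy.trans hs) ((div_mul_cancel₀ _ hs0.ne').le.trans hxy) ht
    exact mul_le_mul hε.2 hs hr.le (by norm_num)
end

section
/- Let (X,d,W) be a hyperbolic space, C ⊆ X a nonempty convex subset, T : C → C asymptotically nonexpansive with sequence (k_n), (λ_n) a sequence in [0,1], and (x_n) the Krasnoselski–Mann iteration starting from x ∈ C. Let n ∈ ℕ, p ∈ C, α > 0, γ ≥ max{d(Tp,p), d(T^n p, p)} and K ≥ k_m for all m ∈ ℕ. Assume that for both i = n and i = n+1 one has d(x_i, p) < α or d(T^i x_i, x_i) < α. Then d(x_{n+1}, T x_{n+1}) < (1 + (1+K)²(2+K))·α + (1+K)²·γ. -/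
open Filter Set

theorem IsKMIteration.mem {X : Type*} [MetricSpace X] {W : X → X → ℝ → X} {C : Set X}
    {T : X → X} {lam : ℕ → ℝ} {x : X} {xseq : ℕ → X} (hKM : IsKMIteration W T lam x xseq)
    (hconv : WConvex W C) (hT : Set.MapsTo T C C) (hlam : ∀ n, lam n ∈ Set.Icc (0:ℝ) 1)
    (hx : x ∈ C) (n : ℕ) : xseq n ∈ C := by
  induction n with
  | zero => rw [hKM.1]; exact hx
  | succ n ih =>
    rw [hKM.2]
    exact hconv _ ih _ (hT.iterate n ih) _ (hlam n)

/-- If `S` is `L`-Lipschitz at the pair `(u, W u (S u) t)`, then passing from `u` to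
`W u (S u) t` increases the displacement of `S` at most by the factor `L`. -/
theorem IsWMap.dist_apply_le {X : Type*} [MetricSpace X] {W : X → X → ℝ → X} (hW : IsWMap W)
    {S : X → X} {u : X} {t L : ℝ} (ht : t ∈ Set.Icc (0:ℝ) 1) (hL : 1 ≤ L)
    (hS : dist (S (W u (S u) t)) (S u) ≤ L * dist (W u (S u) t) u) :
    dist (S (W u (S u) t)) (W u (S u) t) ≤ L * dist u (S u) := by
  obtain ⟨ht0, ht1⟩ := ht
  have hyu := hW.w1 u (S u) u t ⟨ht0, ht1⟩
  rw [dist_self, mul_zero, zero_add, dist_comm] at hyu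
  have hSy := hW.w1 u (S u) (S (W u (S u) t)) t ⟨ht0, ht1⟩
  have htri := dist_triangle_right (S (W u (S u) t)) u (S u)
  set D := dist u (S u)
  have hD : 0 ≤ D := dist_nonneg
  have hSu : dist (S (W u (S u) t)) (S u) ≤ L * (t * D) :=
    hS.trans (mul_le_mul_of_nonneg_left hyu (by linarith))
  calc dist (S (W u (S u) t)) (W u (S u) t)
      ≤ (1 - t) * (L * (t * D) + D) + t * (L * (t * D)) :=
        hSy.trans (add_le_add
          (mul_le_mul_of_nonneg_left (by linarith) (by linarith))
          (mul_le_mul_of_nonneg_left hSu ht0))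
    _ = L * D - (L - 1) * (1 - t) * D := by ring
    _ ≤ L * D := sub_le_self _ (mul_nonneg (mul_nonneg (by linarith) (by linarith)) hD)

/-- The displacement of an `L`-Lipschitz map at `u` in terms of a nearby almost fixed point. -/
theorem dist_apply_le_of_dist_le {X : Type*} [MetricSpace X] {S : X → X} {u p : X} {L γ : ℝ}
    (hS : dist (S u) (S p) ≤ L * dist u p) (hp : dist (S p) p ≤ γ) :
    dist u (S u) ≤ (1 + L) * dist u p + γ := by
  have h₁ := dist_triangle4 u p (S p) (S u)
  rw [dist_comm p (S p), dist_comm (S p) (S u)] at h₁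
  linarith

/-- (Lemma 6.1(2)) case estimate for the Krasnoselski–Mann iteration. -/
theorem KM_case_estimate
    {X : Type*} [MetricSpace X]
    (W : X → X → ℝ → X) (hW : IsWMap W)
    (C : Set X) (hne : C.Nonempty) (hconv : WConvex W C)
    (T : X → X) (k : ℕ → ℝ) (hT : AsymptoticallyNonexpansive C T k)
    (lam : ℕ → ℝ) (hlam : ∀ n, lam n ∈ Set.Icc (0:ℝ) 1)
    (x : X) (hx : x ∈ C) (xseq : ℕ → X) (hKM : IsKMIteration W T lam x xseq)
    (n : ℕ) (p : X) (hp : p ∈ C)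
    (α γ K : ℝ) (hα : 0 < α)
    (hγ1 : dist (T p) p ≤ γ) (hγ2 : dist (T^[n] p) p ≤ γ)
    (hK : ∀ m, k m ≤ K)
    (hcase : ∀ i, i = n ∨ i = n + 1 →
      dist (xseq i) p < α ∨ dist (T^[i] (xseq i)) (xseq i) < α) :
    dist (xseq (n + 1)) (T (xseq (n + 1))) <
      (1 + (1 + K) ^ 2 * (2 + K)) * α + (1 + K) ^ 2 * γ := by
  obtain ⟨hTC, hk, -, hLip⟩ := hT
  have hK0 : 0 ≤ K := (hk 0).trans (hK 0)
  have hγ : 0 ≤ γ := dist_nonneg.trans hγ1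
  have hmem := hKM.mem hconv hTC hlam hx
  have hLipK : ∀ m, ∀ u ∈ C, ∀ v ∈ C, dist (T^[m] u) (T^[m] v) ≤ (1 + K) * dist u v :=
    fun m u hu v hv => (hLip m u hu v hv).trans
      (mul_le_mul_of_nonneg_right (by linarith [hK m]) dist_nonneg)
  have hLipT : ∀ u ∈ C, ∀ v ∈ C, dist (T u) (T v) ≤ (1 + K) * dist u v := hLipK 1
  have hL : 1 ≤ (1 + K) ^ 2 := one_le_pow₀ (by linarith)
  have hαK : 0 ≤ (2 + K) * α := by positivity
  rcases hcase (n + 1) (Or.inr rfl) with hy | hy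
  · have h := dist_apply_le_of_dist_le (hLipT _ (hmem (n + 1)) p hp) hγ1
    have hlt : (1 + (1 + K)) * dist (xseq (n + 1)) p < (1 + (1 + K)) * α :=
      mul_lt_mul_of_pos_left hy (by linarith)
    linarith [le_mul_of_one_le_left hγ hL, le_mul_of_one_le_left hαK hL]
  · have hD : dist (xseq n) (T^[n] (xseq n)) ≤ (2 + K) * α + γ := by
      rcases hcase n (Or.inl rfl) with hn | hn
      · have h := dist_apply_le_of_dist_le (hLipK n _ (hmem n) p hp) hγ2
        have hle : (1 + (1 + K)) * dist (xseq n) p ≤ (1 + (1 + K)) * α :=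
          mul_le_mul_of_nonneg_left hn.le (by linarith)
        linarith
      · rw [dist_comm]
        linarith [mul_nonneg hK0 hα.le]
    have hdisp : dist (T^[n] (xseq (n + 1))) (xseq (n + 1)) ≤
        (1 + K) * dist (xseq n) (T^[n] (xseq n)) := by
      have hS := hLipK n _ (hmem (n + 1)) _ (hmem n)
      rw [hKM.2 n] at hS ⊢
      exact hW.dist_apply_le (hlam n) (by linarith) hS
    have hT' := hLipT _ (hTC.iterate n (hmem (n + 1))) _ (hmem (n + 1))
    rw [← Function.iterate_succ_apply' T] at hT'
    have htri := dist_triangle_left (xseq (n + 1)) (T (xseq (n + 1))) (T^[n + 1] (xseq (n + 1)))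
    calc dist (xseq (n + 1)) (T (xseq (n + 1)))
        < α + (1 + K) * dist (T^[n] (xseq (n + 1))) (xseq (n + 1)) := by linarith
      _ ≤ α + (1 + K) * ((1 + K) * ((2 + K) * α + γ)) := by
          have := hdisp.trans (mul_le_mul_of_nonneg_left hD (by linarith))
          gcongr
      _ = (1 + (1 + K) ^ 2 * (2 + K)) * α + (1 + K) ^ 2 * γ := by ring
end

section
/- Let (X,d,W) be a uniformly convex hyperbolic space with a monotone modulus of uniform convexity η that can be written as η(r,ε) = ε·η̃(r,ε), where η̃ is nondecreasing in ε for each fixed r. Let C ⊆ X be a nonempty convex subset, T : C → C asymptotically nonexpansive with sequence (k_n), (λ_n) a sequence in [0,1], and (x_n) the Krasnoselski–Mann iteration starting from x ∈ C. Let p ∈ C and K ≥ k_m for all m ∈ ℕ. Assume n ∈ ℕ and α, β, β*, β̃, ν > 0 are such that d(T^n p, p) < ν ≤ 1, α ≤ d(x_n, p), d(x_n, p) ≤ β, d(x_n, p) ≤ β̃, d(x_n, p) ≤ β*, and α ≤ d(x_n, T^n x_n). Then d(x_{n+1}, p) < d(x_n, p) + k_n·β* + ν − 2α·λ_n(1−λ_n)·η̃((1+K)β̃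 + 1, α/((1+K)β + 1)). -/
open Filter Set

section Hyperbolic

variable {X : Type*} [MetricSpace X] {W : X → X → ℝ → X} {η : ℝ → ℝ → ℝ}

/-- Every point of `W x y` lies in any closed ball containing `x` and `y`. -/
lemma IsWMap.dist_le_s17 (hW : IsWMap W) {x y a : X} {r t : ℝ} (ht : t ∈ Set.Icc (0 : ℝ) 1)
    (hx : dist x a ≤ r) (hy : dist y a ≤ r) : dist (W x y t) a ≤ r := by
  have h := hW.w1 x y a t ht
  rw [dist_comm x a] at hx
  rw [dist_comm y a] at hy
  rw [dist_comm]
  nlinarith [mul_le_mul_of_nonneg_left hx (sub_nonneg.2 ht.2), mul_le_mul_of_nonneg_left hy ht.1]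

/-- In a uniformly convex hyperbolic space, a point between `x` and `y` is determined by its
distances to `x` and `y`. -/
lemma IsUCModulus.eq_of_dist_le (hW : IsWMap W) (hUC : IsUCModulus W η) {x y z w : X} {s t : ℝ}
    (hs : 0 < s) (hst : s + t ≤ dist x y) (hzx : dist z x ≤ s) (hwx : dist w x ≤ s)
    (hzy : dist z y ≤ t) (hwy : dist w y ≤ t) : z = w := by
  by_contra hne
  have hd : 0 < dist z w := dist_pos.2 hne
  have hε : dist z w / s ∈ Set.Ioc (0 : ℝ) 2 := by
    refine ⟨by positivity, (div_le_iff₀ hs).2 ?_⟩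
    linarith [dist_triangle_right z w x]
  have hη := (hUC.1 s _ hs hε).1
  have hmx := hUC.2 s _ x z w hs hε hzx hwx (div_mul_cancel₀ _ hs.ne').le
  have hmy := hW.dist_le_s17 (t := 1 / 2) (by norm_num) hzy hwy
  have htri := dist_triangle_left x y (W z w (1 / 2))
  nlinarith [mul_pos hη hs]

/-- The uniform convexity estimate at the points of the first half of the segment from `x`
to `y`. -/
lemma IsUCModulus.dist_le_of_le_half (hW : IsWMap W) (hUC : IsUCModulus W η) {a x y : X}
    {r ε t : ℝ} (hr : 0 < r) (hε : ε ∈ Set.Ioc (0 : ℝ) 2) (hx : dist x a ≤ r)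
    (hy : dist y a ≤ r) (hxy : ε * r ≤ dist x y) (ht0 : 0 ≤ t) (ht : t ≤ 1 / 2) :
    dist (W x y t) a ≤ (1 - 2 * t * (1 - t) * η r ε) * r := by
  rcases ht0.eq_or_lt with rfl | htpos
  · simpa using hW.dist_le_s17 (t := 0) (by norm_num) hx hy
  have hd : 0 < dist x y := (mul_pos hε.1 hr).trans_le hxy
  have ht1 : t ∈ Set.Icc (0 : ℝ) 1 := ⟨ht0, by linarith⟩
  have ht2 : 2 * t ∈ Set.Icc (0 : ℝ) 1 := ⟨by linarith, by linarith⟩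
  have half : (1 / 2 : ℝ) ∈ Set.Icc (0 : ℝ) 1 := by norm_num
  set m := W x y (1 / 2) with hm
  have heq : W x y t = W x m (2 * t) := by
    have hmx := hW.w1 x y x _ half
    have hmy := hW.w1 x y y _ half
    have hzx := hW.w1 x y x t ht1
    have hzy := hW.w1 x y y t ht1
    have hwx := hW.w1 x m x _ ht2
    have hwy := hW.w1 x m y _ ht2
    rw [← hm] at hmx hmy
    simp only [dist_self, mul_zero, zero_add, add_zero, dist_comm y x] at hmx hmy hzx hzy hwx hwy
    refine hUC.eq_of_dist_le hW (x := x) (y := y) (s := t * dist x y) (t := (1 - t) * dist x y)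
      (by positivity) (by linarith) ?_ ?_ ?_ ?_
    · rwa [dist_comm]
    · rw [dist_comm]
      nlinarith
    · rwa [dist_comm]
    · rw [dist_comm]
      nlinarith
  have hma : dist m a ≤ (1 - η r ε) * r := hUC.2 r ε a x y hr hε hx hy hxy
  have hw := hW.w1 x m a _ ht2
  have hη := (hUC.1 r ε hr hε).1
  rw [← heq, dist_comm a x, dist_comm a m, dist_comm a] at hw
  have e1 := mul_le_mul_of_nonneg_left hx (sub_nonneg.2 ht2.2)
  have e2 := mul_le_mul_of_nonneg_left hma ht2.1
  have e3 : 0 ≤ 2 * t ^ 2 * (η r ε * r) := by positivity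
  nlinarith

/-- The uniform convexity estimate at an arbitrary point of the segment from `x` to `y`. -/
lemma IsUCModulus.dist_le_s17 (hW : IsWMap W) (hUC : IsUCModulus W η) {a x y : X}
    {r ε t : ℝ} (hr : 0 < r) (hε : ε ∈ Set.Ioc (0 : ℝ) 2) (hx : dist x a ≤ r)
    (hy : dist y a ≤ r) (hxy : ε * r ≤ dist x y) (ht : t ∈ Set.Icc (0 : ℝ) 1) :
    dist (W x y t) a ≤ (1 - 2 * t * (1 - t) * η r ε) * r := by
  rcases le_total t (1 / 2) with h | h
  · exact hUC.dist_le_of_le_half hW hr hε hx hy hxy ht.1 h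
  · rw [hW.w3 x y t ht]
    rw [dist_comm] at hxy
    refine (hUC.dist_le_of_le_half hW hr hε hy hx hxy (sub_nonneg.2 ht.2) (by linarith)).trans_eq ?_
    ring

end Hyperbolic

/-- (Lemma 6.2, second inequality) main technical lemma with `η̃` when
`η(r,ε) = ε·η̃(r,ε)` and `η̃` is nondecreasing in `ε`. -/
theorem main_technical_lemma_etaTilde
    {X : Type*} [MetricSpace X]
    (W : X → X → ℝ → X) (η ηt : ℝ → ℝ → ℝ)
    (hW : IsWMap W) (hUC : IsUCModulus W η) (hMon : MonotoneUCModulus η)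
    (hdecomp : ∀ r : ℝ, 0 < r → ∀ ε ∈ Set.Ioc (0:ℝ) 2, η r ε = ε * ηt r ε)
    (hηtmono : ∀ r : ℝ, ∀ ε₁ ε₂ : ℝ, 0 < ε₁ → ε₁ ≤ ε₂ → ε₂ ≤ 2 → ηt r ε₁ ≤ ηt r ε₂)
    (C : Set X) (hne : C.Nonempty) (hconv : WConvex W C)
    (T : X → X) (k : ℕ → ℝ) (hT : AsymptoticallyNonexpansive C T k)
    (lam : ℕ → ℝ) (hlam : ∀ m, lam m ∈ Set.Icc (0:ℝ) 1)
    (x : X) (hx : x ∈ C) (xseq : ℕ → X) (hKM : IsKMIteration W T lam x xseq)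
    (p : X) (hp : p ∈ C) (K : ℝ) (hK : ∀ m, k m ≤ K)
    (n : ℕ) (α β βs βt ν : ℝ)
    (hα : 0 < α) (hβ : 0 < β) (hβs : 0 < βs) (hβt : 0 < βt) (hν : 0 < ν)
    (hTnp : dist (T^[n] p) p < ν) (hν1 : ν ≤ 1)
    (h1 : α ≤ dist (xseq n) p)
    (h2 : dist (xseq n) p ≤ β) (h3 : dist (xseq n) p ≤ βt) (h4 : dist (xseq n) p ≤ βs)
    (h5 : α ≤ dist (xseq n) (T^[n] (xseq n))) :
    dist (xseq (n + 1)) p <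
      dist (xseq n) p + k n * βs + ν -
        2 * α * lam n * (1 - lam n) * ηt ((1 + K) * βt + 1) (α / ((1 + K) * β + 1)) := by
  obtain ⟨hTmaps, hk, -, hTn⟩ := hT
  have hxC : ∀ m, xseq m ∈ C := by
    intro m
    induction m with
    | zero => rwa [hKM.1]
    | succ m ih => rw [hKM.2]; exact hconv _ ih _ (hTmaps.iterate m ih) _ (hlam m)
  rw [hKM.2]
  have hkn := hk n
  have hKn := hK n
  have hTx := hTn n _ (hxC n) p hp
  have htri := dist_triangle (T^[n] (xseq n)) (T^[n] p) p
  have hTp : 0 ≤ dist (T^[n] p) p := dist_nonneg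
  set δ := dist (xseq n) p
  set r := (1 + k n) * δ + dist (T^[n] p) p with hr
  have hδr : δ ≤ r := by nlinarith
  have hr_le : ∀ b, δ ≤ b → r ≤ (1 + K) * b + 1 := fun b hb => by
    have : (1 + k n) * δ ≤ (1 + K) * b := by gcongr <;> linarith
    linarith
  have hrpos : 0 < r := by linarith
  set R := (1 + K) * βt + 1
  set ε := α / ((1 + K) * β + 1)
  have hrβ := hr_le β h2
  have hε_pos : 0 < ε := div_pos hα (by linarith)
  have hε_le : ε ≤ α / r := div_le_div_of_nonneg_left hα.le hrpos hrβ
  have hαr : α / r ≤ 1 := (div_le_one hrpos).2 (by linarith)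
  have hε : ε ∈ Set.Ioc (0 : ℝ) 2 := ⟨hε_pos, by linarith⟩
  have hαrε : α / r ∈ Set.Ioc (0 : ℝ) 2 := ⟨by positivity, by linarith⟩
  have key := hUC.dist_le_s17 hW hrpos hαrε hδr (y := T^[n] (xseq n)) (by linarith)
    (by rwa [div_mul_cancel₀ _ hrpos.ne'])
    (hlam n)
  have hηt : ηt R ε ≤ ηt r (α / r) := by
    have h := hMon ε hε r R hrpos (hr_le βt h3)
    rw [hdecomp r hrpos ε hε, hdecomp R (hrpos.trans_le (hr_le βt h3)) ε hε] at h
    exact (le_of_mul_le_mul_left h hε_pos).trans (hηtmono r _ _ hε_pos hε_le hαrε.2)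
  have hηr : η r (α / r) * r = α * ηt r (α / r) := by
    rw [hdecomp r hrpos _ hαrε]
    field_simp
  have hcoef : 0 ≤ 2 * α * lam n * (1 - lam n) :=
    mul_nonneg (mul_nonneg (by positivity) (hlam n).1) (sub_nonneg.2 (hlam n).2)
  have hmul := mul_le_mul_of_nonneg_left hηt hcoef
  have hkβ := mul_le_mul_of_nonneg_left h4 hkn
  have hexp : (1 - 2 * lam n * (1 - lam n) * η r (α / r)) * r
      = r - 2 * α * lam n * (1 - lam n) * ηt r (α / r) := by
    linear_combination (-2 * lam n * (1 - lam n)) * hηr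
  rw [hexp] at key
  linarith
end

section
/- Let A₁, A₂ ≥ 1 and B₁, B₂, C₁, C₂ ≥ 0, and for θ > 0 and g : ℕ → ℕ define Ψ := h^M(0), where h(n) := g(n) + n, D_i := (A_i + C_i)·exp(B_i) for i = 1,2, and M := ⌈3(4B₁D₁ + 4C₁ + D₁ + 4B₂D₂ + 4C₂ + D₂)/θ⌉. Let (a_n), (b_n), (c_n), (α_n), (β_n), (γ_n) be real sequences such that for all n ≤ Ψ: a_n, b_n, c_n, α_n, β_n, γ_n ≥ 0, a_{n+1} ≤ (1 + b_n)·a_n + c_n and α_{n+1} ≤ (1 + β_n)·α_n + γ_n; and moreover a_0 ≤ A₁, α_0 ≤ A₂, Σ_{n=0}^Ψ b_n ≤ B₁, Σ_{n=0}^Ψ β_n ≤ B₂, Σ_{n=0}^Ψ c_n ≤ C₁, Σ_{n=0}^Ψ γ_n ≤ C₂. Then: (1) a_n ≤ D₁ and α_n ≤ D₂ for all n ≤ Ψ + 1; (2) if θ ∈ (0,1], there exists N ≤ Ψ such that for all i, j ∈ [N, N + g(N)] one has |a_j − a_i| ≤ θ and |α_j − α_i| ≤ θ; moreover N = h^i(0)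 for some i < M. -/
/-- A discrete Grönwall inequality on an initial segment of the natural numbers. -/
theorem gronwall_add_sum_mul_exp_sum {A : ℝ} {a b c : ℕ → ℝ} {K : ℕ} (hA : 0 ≤ A)
    (hb : ∀ n ≤ K, 0 ≤ b n) (hc : ∀ n ≤ K, 0 ≤ c n)
    (hrec : ∀ n ≤ K, a (n + 1) ≤ (1 + b n) * a n + c n) (ha0 : a 0 ≤ A) :
    ∀ n ≤ K + 1, a n ≤
      (A + ∑ k ∈ Finset.range n, c k) * Real.exp (∑ k ∈ Finset.range n, b k) := by
  intro n
  induction n with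
  | zero => intro _; simpa using ha0
  | succ n ih =>
    intro hn
    have hnK : n ≤ K := by omega
    have ih := ih (by omega)
    rw [Finset.sum_range_succ, Finset.sum_range_succ]
    set X := ∑ k ∈ Finset.range n, c k
    set s := ∑ k ∈ Finset.range n, b k
    have hX : 0 ≤ X := Finset.sum_nonneg fun k hk => hc k (by simp at hk; omega)
    have hs : 0 ≤ s := Finset.sum_nonneg fun k hk => hb k (by simp at hk; omega)
    have hbn := hb n hnK
    calc a (n + 1) ≤ (1 + b n) * a n + c n := hrec n hnK
      _ ≤ Real.exp (b n) * ((A + X) * Real.exp s) + c n * Real.exp (s + b n) := by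
        gcongr ?_ + ?_
        · calc (1 + b n) * a n ≤ (1 + b n) * ((A + X) * Real.exp s) := by gcongr
            _ ≤ _ := by
              gcongr
              linarith [Real.add_one_le_exp (b n)]
        · exact le_mul_of_one_le_right (hc n hnK) (Real.one_le_exp (by positivity))
      _ = (A + (X + c n)) * Real.exp (s + b n) := by rw [Real.exp_add]; ring

theorem le_mul_exp_of_sum_le {A B C : ℝ} {a b c : ℕ → ℝ} {K : ℕ} (hA : 0 ≤ A) (hC : 0 ≤ C)
    (hb : ∀ n ≤ K, 0 ≤ b n) (hc : ∀ n ≤ K, 0 ≤ c n)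
    (hrec : ∀ n ≤ K, a (n + 1) ≤ (1 + b n) * a n + c n) (ha0 : a 0 ≤ A)
    (hbB : ∑ n ∈ Finset.range (K + 1), b n ≤ B) (hcC : ∑ n ∈ Finset.range (K + 1), c n ≤ C)
    {n : ℕ} (hn : n ≤ K + 1) : a n ≤ (A + C) * Real.exp B := by
  have sum_le : ∀ f : ℕ → ℝ, (∀ n ≤ K, 0 ≤ f n) →
      ∑ k ∈ Finset.range n, f k ≤ ∑ k ∈ Finset.range (K + 1), f k := fun f hf =>
    Finset.sum_le_sum_of_subset_of_nonneg (Finset.range_mono hn)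
      fun k hk _ => hf k (by simp at hk; omega)
  refine (gronwall_add_sum_mul_exp_sum hA hb hc hrec ha0 n hn).trans ?_
  gcongr
  · exact (sum_le c hc).trans hcC
  · exact (sum_le b hb).trans hbB

/-- The total variation of a bounded sequence is controlled by its summable upward increments. -/
theorem sum_abs_sub_le {B C D : ℝ} {a b c : ℕ → ℝ} {K : ℕ} (hD : 0 ≤ D)
    (ha : ∀ n ≤ K, 0 ≤ a n) (hb : ∀ n ≤ K, 0 ≤ b n) (hc : ∀ n ≤ K, 0 ≤ c n)
    (hrec : ∀ n ≤ K, a (n + 1) ≤ (1 + b n) * a n + c n) (haD : ∀ n ≤ K, a n ≤ D)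
    (hbB : ∑ n ∈ Finset.range (K + 1), b n ≤ B) (hcC : ∑ n ∈ Finset.range (K + 1), c n ≤ C) :
    ∑ n ∈ Finset.range K, |a (n + 1) - a n| ≤ 2 * (B * D + C) + D := by
  have step : ∀ n ∈ Finset.range K,
      |a (n + 1) - a n| ≤ 2 * (b n * D + c n) - (a (n + 1) - a n) := by
    intro n hn
    have hn : n ≤ K := (Finset.mem_range.1 hn).le
    have h1 : b n * a n ≤ b n * D := mul_le_mul_of_nonneg_left (haD n hn) (hb n hn)
    have h2 : 0 ≤ b n * D := mul_nonneg (hb n hn) hD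
    have h3 := hc n hn
    have h4 := hrec n hn
    rw [abs_le]
    constructor <;> linarith
  have hsum := Finset.sum_le_sum step
  rw [Finset.sum_sub_distrib, Finset.sum_range_sub, ← Finset.mul_sum, Finset.sum_add_distrib,
    ← Finset.sum_mul] at hsum
  rw [Finset.sum_range_succ] at hbB hcC
  have h1 := ha K le_rfl
  have h2 := haD 0 (Nat.zero_le K)
  have h3 : (∑ n ∈ Finset.range K, b n) * D ≤ B * D :=
    mul_le_mul_of_nonneg_right (by linarith [hb K le_rfl]) hD
  linarith [hc K le_rfl]

theorem abs_sub_le_sum_Ico {a : ℕ → ℝ} {p q i j : ℕ} (hpi : p ≤ i) (hiq : i ≤ q)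
    (hpj : p ≤ j) (hjq : j ≤ q) : |a j - a i| ≤ ∑ n ∈ Finset.Ico p q, |a (n + 1) - a n| := by
  wlog hij : i ≤ j generalizing i j
  · rw [abs_sub_comm]
    exact this hpj hjq hpi hiq (by omega)
  rw [← Finset.sum_Ico_sub a hij]
  exact (Finset.abs_sum_le_sum_abs _ _).trans <|
    Finset.sum_le_sum_of_subset_of_nonneg (Finset.Ico_subset_Ico hpi hjq) fun _ _ _ => abs_nonneg _

/-- Some block between consecutive iterates of `h` carries at most the average mass of `f`. -/
theorem exists_sum_Ico_iterate_le {f : ℕ → ℝ} {h : ℕ → ℕ} {M : ℕ} {θ : ℝ}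
    (hh : Monotone fun k => h^[k] 0) (hM : 0 < M)
    (hf : ∑ n ∈ Finset.range (h^[M] 0), f n ≤ M * θ) :
    ∃ k < M, ∑ n ∈ Finset.Ico (h^[k] 0) (h^[k + 1] 0), f n ≤ θ := by
  have split : ∑ k ∈ Finset.range M, ∑ n ∈ Finset.Ico (h^[k] 0) (h^[k + 1] 0), f n =
      ∑ n ∈ Finset.range (h^[M] 0), f n := by
    rw [Finset.sum_congr rfl fun k _ => Finset.sum_Ico_eq_sub f (hh k.le_succ),
      Finset.sum_range_sub fun k => ∑ n ∈ Finset.range (h^[k] 0), f n]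
    simp
  have hne : (Finset.range M).Nonempty := Finset.nonempty_range_iff.2 hM.ne'
  obtain ⟨k, hk, hle⟩ := Finset.exists_le_of_sum_le (g := fun _ => θ) hne
    (by rw [split]; simpa using hf)
  exact ⟨k, Finset.mem_range.1 hk, hle⟩

/-- (quantitative Qihou lemma for two sequences, Proposition 6.4). -/
theorem quantitative_qihou_two_sequences
    (A₁ A₂ B₁ B₂ C₁ C₂ : ℝ)
    (hA₁ : 1 ≤ A₁) (hA₂ : 1 ≤ A₂)
    (hB₁ : 0 ≤ B₁) (hB₂ : 0 ≤ B₂) (hC₁ : 0 ≤ C₁) (hC₂ : 0 ≤ C₂)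
    (θ : ℝ) (hθ : 0 < θ) (g : ℕ → ℕ)
    (h : ℕ → ℕ) (hh : ∀ n, h n = g n + n)
    (D₁ D₂ : ℝ)
    (hD₁ : D₁ = (A₁ + C₁) * Real.exp B₁) (hD₂ : D₂ = (A₂ + C₂) * Real.exp B₂)
    (M : ℕ)
    (hM : M = ⌈3 * (4 * B₁ * D₁ + 4 * C₁ + D₁ + 4 * B₂ * D₂ + 4 * C₂ + D₂) / θ⌉₊)
    (Ψ : ℕ) (hΨ : Ψ = h^[M] 0)
    (a b c α β γ : ℕ → ℝ)
    (hpos : ∀ n ≤ Ψ, 0 ≤ a n ∧ 0 ≤ b n ∧ 0 ≤ c n ∧ 0 ≤ α n ∧ 0 ≤ β n ∧ 0 ≤ γ n)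
    (hrec1 : ∀ n ≤ Ψ, a (n + 1) ≤ (1 + b n) * a n + c n)
    (hrec2 : ∀ n ≤ Ψ, α (n + 1) ≤ (1 + β n) * α n + γ n)
    (ha0 : a 0 ≤ A₁) (hα0 : α 0 ≤ A₂)
    (hbB : ∑ n ∈ Finset.range (Ψ + 1), b n ≤ B₁)
    (hβB : ∑ n ∈ Finset.range (Ψ + 1), β n ≤ B₂)
    (hcC : ∑ n ∈ Finset.range (Ψ + 1), c n ≤ C₁)
    (hγC : ∑ n ∈ Finset.range (Ψ + 1), γ n ≤ C₂) :
    (∀ n ≤ Ψ + 1, a n ≤ D₁ ∧ α n ≤ D₂) ∧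
    (θ ≤ 1 → ∃ N ≤ Ψ,
      (∀ i, N ≤ i → i ≤ N + g N → ∀ j, N ≤ j → j ≤ N + g N →
        |a j - a i| ≤ θ ∧ |α j - α i| ≤ θ) ∧
      ∃ i < M, N = h^[i] 0) := by
  have hD₁0 : 0 < D₁ := by rw [hD₁]; positivity
  have hD₂0 : 0 < D₂ := by rw [hD₂]; positivity
  have ha : ∀ n ≤ Ψ, 0 ≤ a n := fun n hn => (hpos n hn).1
  have hb : ∀ n ≤ Ψ, 0 ≤ b n := fun n hn => (hpos n hn).2.1
  have hc : ∀ n ≤ Ψ, 0 ≤ c n := fun n hn => (hpos n hn).2.2.1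
  have hα : ∀ n ≤ Ψ, 0 ≤ α n := fun n hn => (hpos n hn).2.2.2.1
  have hβ : ∀ n ≤ Ψ, 0 ≤ β n := fun n hn => (hpos n hn).2.2.2.2.1
  have hγ : ∀ n ≤ Ψ, 0 ≤ γ n := fun n hn => (hpos n hn).2.2.2.2.2
  have haD : ∀ n ≤ Ψ + 1, a n ≤ D₁ := fun n hn => hD₁ ▸
    le_mul_exp_of_sum_le (by linarith) hC₁ hb hc hrec1 ha0 hbB hcC hn
  have hαD : ∀ n ≤ Ψ + 1, α n ≤ D₂ := fun n hn => hD₂ ▸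
    le_mul_exp_of_sum_le (by linarith) hC₂ hβ hγ hrec2 hα0 hβB hγC hn
  refine ⟨fun n hn => ⟨haD n hn, hαD n hn⟩, fun _ => ?_⟩
  have hmono : Monotone fun k => h^[k] 0 := monotone_nat_of_le_succ fun k => by
    rw [Function.iterate_succ_apply', hh]
    omega
  have hBD₁ : 0 ≤ B₁ * D₁ := by positivity
  have hBD₂ : 0 ≤ B₂ * D₂ := by positivity
  have hMθ : 3 * (4 * B₁ * D₁ + 4 * C₁ + D₁ + 4 * B₂ * D₂ + 4 * C₂ + D₂) ≤ M * θ :=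
    (div_le_iff₀ hθ).1 (hM ▸ Nat.le_ceil _)
  have hM0 : 0 < M := by
    rw [hM, Nat.ceil_pos]
    positivity
  have hva := sum_abs_sub_le hD₁0.le ha hb hc hrec1 (fun n hn => haD n (by omega)) hbB hcC
  have hvα := sum_abs_sub_le hD₂0.le hα hβ hγ hrec2 (fun n hn => hαD n (by omega)) hβB hγC
  obtain ⟨k, hk, hle⟩ := exists_sum_Ico_iterate_le
    (f := fun n => |a (n + 1) - a n| + |α (n + 1) - α n|) hmono hM0 (θ := θ)
    (by rw [← hΨ, Finset.sum_add_distrib]; linarith)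
  refine ⟨h^[k] 0, hΨ ▸ hmono hk.le, fun i hi hi' j hj hj' => ?_, k, hk, rfl⟩
  rw [Function.iterate_succ_apply', hh, add_comm (g _), Finset.sum_add_distrib] at hle
  have h1 := abs_sub_le_sum_Ico (a := a) hi hi' hj hj'
  have h2 := abs_sub_le_sum_Ico (a := α) hi hi' hj hj'
  constructor <;> linarith [abs_nonneg (a j - a i), abs_nonneg (α j - α i)]
end
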